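/- arXiv:1906.04733 — 5 statements merged into one kernel-verified Lean document; each statement's English description precedes it below -/
import Mathlib

section
/- The flow-conservation equation uniquely determines the discounted state occupancy: if d : S → ℝ satisfies d(s') = (1−γ) β(s') + γ Σ_{s∈S} Σ_{a∈A} d(s) π(a|s) T(s'|s,a) for every s' ∈ S, then d(s) = Σ_{a∈A} d^π(s,a) for every s ∈ S. -/
open scoped BigOperators

/-- The t-step state distributions: `betaT T pi beta 0 = beta` and
`betaT T pi beta (t+1) s' = ∑ s, ∑ a, betaT T pi beta t s * pi s a * T s a s'`. -/
def betaT {S A : Type*} [Fintype S] [Fintype A]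
    (T : S → A → S → ℝ) (pi : S → A → ℝ) (beta : S → ℝ) : ℕ → S → ℝ
  | 0 => beta
  | t + 1 => fun s' => ∑ s, ∑ a, betaT T pi beta t s * pi s a * T s a s'

/-- The discounted occupancy `d^π(s,a) = (1−γ) ∑_t γ^t β_t(s) π(a|s)`. -/
noncomputable def dPi {S A : Type*} [Fintype S] [Fintype A]
    (γ : ℝ) (T : S → A → S → ℝ) (pi : S → A → ℝ) (beta : S → ℝ) (s : S) (a : A) : ℝ :=
  (1 - γ) * ∑' t : ℕ, γ ^ t * betaT T pi beta t s * pi s a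


theorem betaT_bound {S A : Type*} [Fintype S] [Fintype A]
    (T : S → A → S → ℝ) (pi : S → A → ℝ) (x : S → ℝ)
    (hT0 : ∀ s a s', 0 ≤ T s a s') (hT1 : ∀ s a, ∑ s', T s a s' = 1)
    (hpi0 : ∀ s a, 0 ≤ pi s a) (hpi1 : ∀ s, ∑ a, pi s a = 1) (n : ℕ) :
    ∑ s, |betaT T pi x n s| ≤ ∑ s, |x s| := by
  induction n with
  | zero => exact le_rfl
  | succ n ih =>
    refine le_trans ?_ ih
    calc ∑ s', |betaT T pi x (n+1) s'|
        ≤ ∑ s', ∑ s, ∑ a, |betaT T pi x n s| * pi s a * T s a s' := by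
          refine Finset.sum_le_sum fun s' _ => ?_
          refine (Finset.abs_sum_le_sum_abs _ _).trans (Finset.sum_le_sum fun s _ => ?_)
          refine (Finset.abs_sum_le_sum_abs _ _).trans (Finset.sum_le_sum fun a _ => ?_)
          rw [abs_mul, abs_mul, abs_of_nonneg (hpi0 s a), abs_of_nonneg (hT0 s a s')]
      _ = ∑ s, |betaT T pi x n s| := by
          rw [Finset.sum_comm]
          refine Finset.sum_congr rfl fun s _ => ?_
          rw [Finset.sum_comm]
          simp_rw [← Finset.mul_sum, hT1, mul_one, ← Finset.mul_sum, hpi1, mul_one]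

theorem betaT_step {S A : Type*} [Fintype S] [Fintype A]
    (T : S → A → S → ℝ) (pi : S → A → ℝ) (beta : S → ℝ) (γ : ℝ) (d : S → ℝ)
    (hd : ∀ s' : S,
      d s' = (1 - γ) * beta s' + γ * ∑ s, ∑ a, d s * pi s a * T s a s') (n : ℕ) :
    ∀ s, betaT T pi d n s
      = (1 - γ) * betaT T pi beta n s + γ * betaT T pi d (n+1) s := by
  induction n with
  | zero => exact hd
  | succ n ih =>
    intro s'
    have e : ∀ (x : S → ℝ) (m : ℕ), betaT T pi x (m+1) s'
      = ∑ s, ∑ a, betaT T pi x m s * pi s a * T s a s' := fun _ _ => rfl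
    rw [e d (n+1), e beta n, e d n]
    simp_rw [Finset.mul_sum, ← Finset.sum_add_distrib]
    refine Finset.sum_congr rfl fun s _ => Finset.sum_congr rfl fun a _ => ?_
    rw [ih s]; ring

theorem flow_conservation_unique {S A : Type*} [Fintype S] [Fintype A] [Nonempty S] [Nonempty A]
    (T : S → A → S → ℝ) (pi : S → A → ℝ) (beta : S → ℝ) (γ : ℝ)
    (hT0 : ∀ s a s', 0 ≤ T s a s') (hT1 : ∀ s a, ∑ s', T s a s' = 1)
    (hpi0 : ∀ s a, 0 ≤ pi s a) (hpi1 : ∀ s, ∑ a, pi s a = 1)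
    (hbeta0 : ∀ s, 0 ≤ beta s) (hbeta1 : ∑ s, beta s = 1)
    (hγ0 : 0 ≤ γ) (hγ1 : γ < 1)
    (d : S → ℝ)
    (hd : ∀ s' : S,
      d s' = (1 - γ) * beta s' + γ * ∑ s, ∑ a, d s * pi s a * T s a s') :
    ∀ s : S, d s = ∑ a, dPi γ T pi beta s a := by
  have bd : ∀ (x : S → ℝ) (n : ℕ) (s : S), |betaT T pi x n s| ≤ ∑ s, |x s| := fun x n s =>
    (Finset.single_le_sum (f := fun s => |betaT T pi x n s|)
      (fun _ _ => abs_nonneg _) (Finset.mem_univ s)).trans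
      (betaT_bound T pi x hT0 hT1 hpi0 hpi1 n)
  have summ : ∀ (x : S → ℝ) (s : S), Summable fun n : ℕ => γ ^ n * betaT T pi x n s := by
    intro x s
    refine Summable.of_norm_bounded
      ((summable_geometric_of_lt_one hγ0 hγ1).mul_right (∑ s, |x s|)) fun n => ?_
    rw [Real.norm_eq_abs, abs_mul, abs_of_nonneg (pow_nonneg hγ0 n)]
    exact mul_le_mul_of_nonneg_left (bd x n s) (pow_nonneg hγ0 n)
  intro s
  have unroll : ∀ n : ℕ, d s - γ ^ n * betaT T pi d n s
      = (1 - γ) * ∑ t ∈ Finset.range n, γ ^ t * betaT T pi beta t s := by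
    intro n
    induction n with
    | zero => simp [betaT]
    | succ n ih =>
      rw [Finset.sum_range_succ, mul_add, ← ih, betaT_step T pi beta γ d hd n s]
      ring
  have l1 : Filter.Tendsto (fun n : ℕ => d s - γ ^ n * betaT T pi d n s) Filter.atTop
      (nhds (d s - 0)) := (summ d s).tendsto_atTop_zero.const_sub _
  have l2 := ((summ beta s).hasSum.tendsto_sum_nat).const_mul (1 - γ)
  simp_rw [unroll] at l1
  have key := tendsto_nhds_unique l1 l2
  rw [sub_zero] at key
  rw [key]
  simp_rw [dPi, tsum_mul_right]
  rw [← Finset.mul_sum, ← Finset.mul_sum, hpi1, mul_one]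
end

section
/- Change-of-variables (telescoping) identity: for every function ν : S × A → ℝ, Σ_{(s,a)} d^π(s,a) · (ν(s,a) − (B^π ν)(s,a)) = (1−γ) Σ_{s∈S} Σ_{a∈A} β(s) π(a|s) ν(s,a). -/
open scoped BigOperators

/-- The (reward-free) expected Bellman operator
`(B^π ν)(s,a) = γ ∑_{s'} T(s'|s,a) ∑_{a'} π(a'|s') ν(s',a')`. -/
noncomputable def Bpi {S A : Type*} [Fintype S] [Fintype A]
    (γ : ℝ) (T : S → A → S → ℝ) (pi : S → A → ℝ) (ν : S → A → ℝ) (s : S) (a : A) : ℝ :=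
  γ * ∑ s', T s a s' * ∑ a', pi s' a' * ν s' a'

theorem betaT_nonneg_sum {S A : Type*} [Fintype S] [Fintype A]
    (T : S → A → S → ℝ) (pi : S → A → ℝ) (beta : S → ℝ)
    (hT0 : ∀ s a s', 0 ≤ T s a s') (hT1 : ∀ s a, ∑ s', T s a s' = 1)
    (hpi0 : ∀ s a, 0 ≤ pi s a) (hpi1 : ∀ s, ∑ a, pi s a = 1)
    (hbeta0 : ∀ s, 0 ≤ beta s) (hbeta1 : ∑ s, beta s = 1) (t : ℕ) :
    (∀ s, 0 ≤ betaT T pi beta t s) ∧ ∑ s, betaT T pi beta t s = 1 := by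
  induction t with
  | zero => exact ⟨hbeta0, hbeta1⟩
  | succ t ih =>
    obtain ⟨h0, h1⟩ := ih
    refine ⟨fun s' => ?_, ?_⟩
    · exact Finset.sum_nonneg fun s _ => Finset.sum_nonneg fun a _ =>
        mul_nonneg (mul_nonneg (h0 s) (hpi0 s a)) (hT0 s a s')
    · simp only [betaT]
      rw [Finset.sum_comm]
      rw [← h1]
      refine Finset.sum_congr rfl fun s _ => ?_
      rw [Finset.sum_comm]
      simp only [← Finset.mul_sum, hT1, hpi1, mul_one]

theorem change_of_variables_telescoping {S A : Type*} [Fintype S] [Fintype A]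
    [Nonempty S] [Nonempty A]
    (T : S → A → S → ℝ) (pi : S → A → ℝ) (beta : S → ℝ) (γ : ℝ)
    (hT0 : ∀ s a s', 0 ≤ T s a s') (hT1 : ∀ s a, ∑ s', T s a s' = 1)
    (hpi0 : ∀ s a, 0 ≤ pi s a) (hpi1 : ∀ s, ∑ a, pi s a = 1)
    (hbeta0 : ∀ s, 0 ≤ beta s) (hbeta1 : ∑ s, beta s = 1)
    (hγ0 : 0 ≤ γ) (hγ1 : γ < 1) :
    ∀ ν : S → A → ℝ,
      (∑ s, ∑ a, dPi γ T pi beta s a * (ν s a - Bpi γ T pi ν s a)) =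
        (1 - γ) * ∑ s, ∑ a, beta s * pi s a * ν s a := by
  intro ν
  have hb := betaT_nonneg_sum T pi beta hT0 hT1 hpi0 hpi1 hbeta0 hbeta1
  have hsum : ∀ s, Summable fun t : ℕ => γ ^ t * betaT T pi beta t s := by
    intro s
    refine Summable.of_nonneg_of_le (fun t => mul_nonneg (pow_nonneg hγ0 t) ((hb t).1 s))
      (fun t => ?_) (summable_geometric_of_lt_one hγ0 hγ1)
    have h1 : betaT T pi beta t s ≤ 1 := by
      rw [← (hb t).2]
      exact Finset.single_le_sum (fun i _ => (hb t).1 i) (Finset.mem_univ s)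
    exact mul_le_of_le_one_right (pow_nonneg hγ0 t) h1
  obtain ⟨D, hD⟩ : ∃ D : S → ℝ, ∀ s, HasSum (fun t : ℕ => γ ^ t * betaT T pi beta t s) (D s) :=
    ⟨_, fun s => (hsum s).hasSum⟩
  have hd : ∀ s a, dPi γ T pi beta s a = (1 - γ) * (D s * pi s a) := by
    intro s a
    rw [dPi, ((hD s).mul_right (pi s a)).tsum_eq]
  have hflow : ∀ s', D s' = beta s' + γ * ∑ s, ∑ a, D s * pi s a * T s a s' := by
    intro s'
    have h1 : HasSum (fun t : ℕ => γ * ∑ s, ∑ a, (γ ^ t * betaT T pi beta t s) * pi s a * T s a s')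
        (γ * ∑ s, ∑ a, D s * pi s a * T s a s') :=
      (hasSum_sum fun s _ => hasSum_sum fun a _ =>
        ((hD s).mul_right (pi s a)).mul_right (T s a s')).mul_left γ
    have h2 := (hasSum_nat_add_iff' 1).2 (hD s')
    have h3 : (fun t : ℕ => γ ^ (t + 1) * betaT T pi beta (t + 1) s') =
        (fun t : ℕ => γ * ∑ s, ∑ a, (γ ^ t * betaT T pi beta t s) * pi s a * T s a s') := by
      funext t
      simp only [betaT, Finset.mul_sum]
      refine Finset.sum_congr rfl fun s _ => Finset.sum_congr rfl fun a _ => ?_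
      ring
    rw [h3] at h2
    have h4 := h2.unique h1
    simp [betaT] at h4
    linarith
  have key : ∑ s, ∑ a, D s * pi s a * Bpi γ T pi ν s a
      = ∑ s', (γ * ∑ s, ∑ a, D s * pi s a * T s a s') * ∑ a', pi s' a' * ν s' a' := by
    have : ∀ V : S → ℝ, ∑ s, ∑ a, D s * pi s a * (γ * ∑ s', T s a s' * V s')
        = ∑ s', (γ * ∑ s, ∑ a, D s * pi s a * T s a s') * V s' := by
      intro V
      simp only [Finset.mul_sum, Finset.sum_mul]
      rw [Finset.sum_comm (s := Finset.univ (α := S)) (t := Finset.univ (α := S))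
        (f := fun s' s => ∑ a, γ * (D s * pi s a * T s a s') * V s')]
      refine Finset.sum_congr rfl fun s _ => ?_
      rw [Finset.sum_comm]
      refine Finset.sum_congr rfl fun s' _ => Finset.sum_congr rfl fun a _ => ?_
      ring
    exact this _
  have e1 : ∑ s, ∑ a, dPi γ T pi beta s a * (ν s a - Bpi γ T pi ν s a)
      = (1 - γ) * (∑ s, D s * (∑ a, pi s a * ν s a) - ∑ s, ∑ a, D s * pi s a * Bpi γ T pi ν s a) := by
    rw [← Finset.sum_sub_distrib, Finset.mul_sum]
    refine Finset.sum_congr rfl fun s _ => ?_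
    rw [Finset.mul_sum, ← Finset.sum_sub_distrib, Finset.mul_sum]
    refine Finset.sum_congr rfl fun a _ => ?_
    rw [hd]; ring
  rw [e1, key, ← Finset.sum_sub_distrib]
  congr 1
  refine Finset.sum_congr rfl fun s _ => ?_
  rw [← sub_mul, sub_eq_of_eq_add (hflow s), Finset.mul_sum]
  exact Finset.sum_congr rfl fun a _ => by ring
end

section
/- The objective J(ν) has a unique minimizer ν* over all functions ν : S × A → ℝ, and the Bellman residual of ν* equals the stationary distribution correction: (ν* − B^π ν*)(s,a) = w(s,a) for every (s,a) ∈ S × A. Equivalently, the unique solution ν* of ν = w + B^π ν is the unique minimizer of J. -/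
open scoped BigOperators

theorem aux_beta_nonneg {S A : Type*} [Fintype S] [Fintype A]
    (T : S → A → S → ℝ) (pi : S → A → ℝ) (beta : S → ℝ)
    (hT0 : ∀ s a s', 0 ≤ T s a s') (hpi0 : ∀ s a, 0 ≤ pi s a)
    (hbeta0 : ∀ s, 0 ≤ beta s) (t : ℕ) : ∀ s, 0 ≤ betaT T pi beta t s := by
  induction t with
  | zero => exact hbeta0
  | succ t ih =>
    intro s
    exact Finset.sum_nonneg fun x _ => Finset.sum_nonneg fun a _ =>
      mul_nonneg (mul_nonneg (ih x) (hpi0 x a)) (hT0 x a s)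

theorem aux_beta_sum {S A : Type*} [Fintype S] [Fintype A]
    (T : S → A → S → ℝ) (pi : S → A → ℝ) (beta : S → ℝ)
    (hT1 : ∀ s a, ∑ s', T s a s' = 1) (hpi1 : ∀ s, ∑ a, pi s a = 1)
    (hbeta1 : ∑ s, beta s = 1) (t : ℕ) : ∑ s, betaT T pi beta t s = 1 := by
  induction t with
  | zero => exact hbeta1
  | succ t ih =>
    change ∑ s', ∑ s, ∑ a, betaT T pi beta t s * pi s a * T s a s' = 1
    rw [Finset.sum_comm, ← ih]
    refine Finset.sum_congr rfl fun s _ => ?_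
    rw [Finset.sum_comm]
    simp_rw [← Finset.mul_sum, hT1, mul_one, ← Finset.mul_sum, hpi1, mul_one]

theorem aux_inj {S A : Type*} [Fintype S] [Fintype A] [Nonempty S] [Nonempty A]
    (T : S → A → S → ℝ) (pi : S → A → ℝ) (γ : ℝ)
    (hT0 : ∀ s a s', 0 ≤ T s a s') (hT1 : ∀ s a, ∑ s', T s a s' = 1)
    (hpi0 : ∀ s a, 0 ≤ pi s a) (hpi1 : ∀ s, ∑ a, pi s a = 1)
    (hγ0 : 0 ≤ γ) (hγ1 : γ < 1) (ν : S → A → ℝ)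
    (h : ∀ s a, ν s a - Bpi γ T pi ν s a = 0) : ν = 0 := by
  obtain ⟨⟨s0, a0⟩, hm⟩ := Finite.exists_max (fun p : S × A => |ν p.1 p.2|)
  have hM : ∀ s a, |ν s a| ≤ |ν s0 a0| := fun s a => hm (s, a)
  have h1 : ∀ s', |∑ a', pi s' a' * ν s' a'| ≤ |ν s0 a0| := by
    intro s'
    calc _ ≤ ∑ a', |pi s' a' * ν s' a'| := Finset.abs_sum_le_sum_abs _ _
      _ ≤ ∑ a', pi s' a' * |ν s0 a0| := by
        refine Finset.sum_le_sum fun a _ => ?_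
        rw [abs_mul, abs_of_nonneg (hpi0 s' a)]
        exact mul_le_mul_of_nonneg_left (hM s' a) (hpi0 s' a)
      _ = _ := by rw [← Finset.sum_mul, hpi1, one_mul]
  have h2 : |∑ s', T s0 a0 s' * ∑ a', pi s' a' * ν s' a'| ≤ |ν s0 a0| := by
    calc _ ≤ ∑ s', |T s0 a0 s' * ∑ a', pi s' a' * ν s' a'| := Finset.abs_sum_le_sum_abs _ _
      _ ≤ ∑ s', T s0 a0 s' * |ν s0 a0| := by
        refine Finset.sum_le_sum fun s _ => ?_
        rw [abs_mul, abs_of_nonneg (hT0 s0 a0 s)]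
        exact mul_le_mul_of_nonneg_left (h1 s) (hT0 s0 a0 s)
      _ = _ := by rw [← Finset.sum_mul, hT1, one_mul]
  have h3 : |ν s0 a0| ≤ γ * |ν s0 a0| := by
    have := sub_eq_zero.mp (h s0 a0)
    calc |ν s0 a0| = |Bpi γ T pi ν s0 a0| := by rw [← this]
      _ = γ * |∑ s', T s0 a0 s' * ∑ a', pi s' a' * ν s' a'| := by
        rw [Bpi, abs_mul, abs_of_nonneg hγ0]
      _ ≤ _ := mul_le_mul_of_nonneg_left h2 hγ0
  have h4 : |ν s0 a0| ≤ 0 := by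
    have := abs_nonneg (ν s0 a0)
    by_contra hc
    nlinarith
  funext s a
  exact abs_nonpos_iff.mp ((hM s a).trans h4)

noncomputable def resLin {S A : Type*} [Fintype S] [Fintype A]
    (T : S → A → S → ℝ) (pi : S → A → ℝ) (γ : ℝ) : (S → A → ℝ) →ₗ[ℝ] (S → A → ℝ) where
  toFun ν := fun s a => ν s a - Bpi γ T pi ν s a
  map_add' x y := by
    funext s a
    simp only [Bpi, Pi.add_apply, mul_add, Finset.sum_add_distrib]
    ring
  map_smul' c x := by
    funext s a
    simp only [Bpi, Pi.smul_apply, smul_eq_mul, RingHom.id_apply, mul_sub, Finset.mul_sum]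
    congr 1
    refine Finset.sum_congr rfl fun s' _ => Finset.sum_congr rfl fun a' _ => ?_
    ring

theorem aux_flow {S A : Type*} [Fintype S] [Fintype A]
    (T : S → A → S → ℝ) (pi : S → A → ℝ) (beta : S → ℝ) (γ : ℝ)
    (hT0 : ∀ s a s', 0 ≤ T s a s') (hT1 : ∀ s a, ∑ s', T s a s' = 1)
    (hpi0 : ∀ s a, 0 ≤ pi s a) (hpi1 : ∀ s, ∑ a, pi s a = 1)
    (hbeta0 : ∀ s, 0 ≤ beta s) (hbeta1 : ∑ s, beta s = 1)
    (hγ0 : 0 ≤ γ) (hγ1 : γ < 1) (ν : S → A → ℝ) :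
    ∑ s, ∑ a, dPi γ T pi beta s a * (ν s a - Bpi γ T pi ν s a)
      = (1 - γ) * ∑ s, ∑ a, beta s * pi s a * ν s a := by
  have hsum : ∀ s, Summable fun t : ℕ => γ ^ t * betaT T pi beta t s := by
    intro s
    refine Summable.of_nonneg_of_le
      (fun t => mul_nonneg (pow_nonneg hγ0 t) (aux_beta_nonneg T pi beta hT0 hpi0 hbeta0 t s))
      (fun t => ?_) (summable_geometric_of_lt_one hγ0 hγ1)
    have : betaT T pi beta t s ≤ 1 := by
      rw [← aux_beta_sum T pi beta hT1 hpi1 hbeta1 t]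
      exact Finset.single_le_sum
        (fun x _ => aux_beta_nonneg T pi beta hT0 hpi0 hbeta0 t x) (Finset.mem_univ s)
    exact mul_le_of_le_one_right (pow_nonneg hγ0 t) this
  obtain ⟨D, hD⟩ : ∃ D : S → ℝ, ∀ s, HasSum (fun t : ℕ => γ ^ t * betaT T pi beta t s) (D s) :=
    ⟨_, fun s => (hsum s).hasSum⟩
  have hd : ∀ s a, dPi γ T pi beta s a = (1 - γ) * (D s * pi s a) := by
    intro s a
    rw [dPi, ((hD s).mul_right (pi s a)).tsum_eq]
  have hflow : ∀ s', D s' = beta s' + γ * ∑ s, ∑ a, D s * pi s a * T s a s' := by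
    intro s'
    have e1 : HasSum (fun t : ℕ => γ ^ (t+1) * betaT T pi beta (t+1) s')
        (γ * ∑ s, ∑ a, D s * pi s a * T s a s') := by
      have : HasSum (fun t : ℕ => γ * ∑ s, ∑ a, (γ ^ t * betaT T pi beta t s) * pi s a * T s a s')
          (γ * ∑ s, ∑ a, D s * pi s a * T s a s') :=
        (hasSum_sum fun s _ => hasSum_sum fun a _ =>
          ((hD s).mul_right (pi s a)).mul_right (T s a s')).mul_left γ
      convert this using 2 with t
      simp only [betaT, Finset.mul_sum]
      refine Finset.sum_congr rfl fun s _ => Finset.sum_congr rfl fun a _ => ?_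
      ring
    have e2 := (hasSum_nat_add_iff' (f := fun t : ℕ => γ ^ t * betaT T pi beta t s') 1).mpr (hD s')
    have e3 := e1.unique e2
    simp [betaT] at e3
    linarith
  -- value of the second part
  set V : S → ℝ := fun s => ∑ a, pi s a * ν s a with hV
  have l1 : ∑ s, ∑ a, D s * pi s a * ν s a = ∑ s, D s * V s := by
    simp only [hV, Finset.mul_sum, mul_assoc]
  have l2 : ∑ s, ∑ a, beta s * pi s a * ν s a = ∑ s, beta s * V s := by
    simp only [hV, Finset.mul_sum, mul_assoc]
  have l3 : ∑ s, ∑ a, D s * pi s a * Bpi γ T pi ν s a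
      = ∑ s', (γ * ∑ s, ∑ a, D s * pi s a * T s a s') * V s' := by
    simp only [Bpi]
    change ∑ s, ∑ a, D s * pi s a * (γ * ∑ s', T s a s' * V s') = _
    simp only [Finset.mul_sum, Finset.sum_mul]
    symm
    rw [Finset.sum_comm]
    refine Finset.sum_congr rfl fun s _ => ?_
    rw [Finset.sum_comm]
    refine Finset.sum_congr rfl fun a _ => Finset.sum_congr rfl fun s' _ => ?_
    ring
  have l4 : ∑ s, D s * V s = ∑ s, beta s * V s
      + ∑ s', (γ * ∑ s, ∑ a, D s * pi s a * T s a s') * V s' := by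
    rw [← Finset.sum_add_distrib]
    refine Finset.sum_congr rfl fun s _ => ?_
    rw [← add_mul, ← hflow]
  simp only [hd, mul_assoc (1 - γ), ← Finset.mul_sum]
  congr 1
  simp only [mul_sub, Finset.sum_sub_distrib]
  rw [l1, l2, l3, l4]
  ring

theorem J_unique_minimizer_residual_eq_correction
    {S A : Type*} [Fintype S] [Fintype A] [Nonempty S] [Nonempty A]
    (T : S → A → S → ℝ) (pi : S → A → ℝ) (beta : S → ℝ) (γ : ℝ) (dD : S → A → ℝ)
    (hT0 : ∀ s a s', 0 ≤ T s a s') (hT1 : ∀ s a, ∑ s', T s a s' = 1)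
    (hpi0 : ∀ s a, 0 ≤ pi s a) (hpi1 : ∀ s, ∑ a, pi s a = 1)
    (hbeta0 : ∀ s, 0 ≤ beta s) (hbeta1 : ∑ s, beta s = 1)
    (hγ0 : 0 ≤ γ) (hγ1 : γ < 1)
    (hdD0 : ∀ s a, 0 < dD s a) (hdD1 : ∑ s, ∑ a, dD s a = 1)
    (w : S → A → ℝ) (hw : ∀ s a, w s a = dPi γ T pi beta s a / dD s a)
    (J : (S → A → ℝ) → ℝ)
    (hJ : ∀ ν : S → A → ℝ,
      J ν = (1 / 2) * (∑ s, ∑ a, dD s a * (ν s a - Bpi γ T pi ν s a) ^ 2)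
              - (1 - γ) * ∑ s, ∑ a, beta s * pi s a * ν s a) :
    ∃ νstar : S → A → ℝ,
      (∀ ν : S → A → ℝ, J νstar ≤ J ν) ∧
      (∀ ν' : S → A → ℝ, (∀ ν : S → A → ℝ, J ν' ≤ J ν) → ν' = νstar) ∧
      (∀ s a, νstar s a - Bpi γ T pi νstar s a = w s a) ∧
      (∀ s a, νstar s a = w s a + Bpi γ T pi νstar s a) := by
  have hinj : Function.Injective (resLin T pi γ) := by
    refine (injective_iff_map_eq_zero _).mpr fun ν h => ?_
    exact aux_inj T pi γ hT0 hT1 hpi0 hpi1 hγ0 hγ1 ν fun s a => congrFun (congrFun h s) a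
  obtain ⟨νs, hνs⟩ := (LinearMap.injective_iff_surjective.mp hinj) w
  have hres : ∀ s a, νs s a - Bpi γ T pi νs s a = w s a :=
    fun s a => congrFun (congrFun hνs s) a
  have hJ' : ∀ ν, J ν = (1 / 2) * (∑ s, ∑ a, dD s a * (ν s a - Bpi γ T pi ν s a - w s a) ^ 2)
      - (1 / 2) * ∑ s, ∑ a, dD s a * w s a ^ 2 := by
    intro ν
    rw [hJ, ← aux_flow T pi beta γ hT0 hT1 hpi0 hpi1 hbeta0 hbeta1 hγ0 hγ1 ν]
    simp only [Finset.mul_sum, ← Finset.sum_sub_distrib]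
    refine Finset.sum_congr rfl fun s _ => Finset.sum_congr rfl fun a _ => ?_
    have : dPi γ T pi beta s a = dD s a * w s a := by
      rw [hw, mul_div_cancel₀ _ (hdD0 s a).ne']
    rw [this]
    ring
  have hJs : J νs = - ((1 / 2) * ∑ s, ∑ a, dD s a * w s a ^ 2) := by
    rw [hJ']
    simp [hres]
  have hnn : ∀ ν : S → A → ℝ, ∀ s a, 0 ≤ dD s a * (ν s a - Bpi γ T pi ν s a - w s a) ^ 2 :=
    fun ν s a => mul_nonneg (hdD0 s a).le (sq_nonneg _)
  refine ⟨νs, fun ν => ?_, fun ν' h => ?_, hres, fun s a => by linarith [hres s a]⟩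
  · have := Finset.sum_nonneg fun s (_ : s ∈ Finset.univ) =>
      Finset.sum_nonneg fun a (_ : a ∈ Finset.univ) => hnn ν s a
    rw [hJs, hJ' ν]
    linarith
  · have h0 := Finset.sum_nonneg fun s (_ : s ∈ Finset.univ) =>
      Finset.sum_nonneg fun a (_ : a ∈ Finset.univ) => hnn ν' s a
    have h1 := h νs
    rw [hJs, hJ' ν'] at h1
    have h2 : ∑ s, ∑ a, dD s a * (ν' s a - Bpi γ T pi ν' s a - w s a) ^ 2 = 0 := by linarith
    apply hinj
    rw [hνs]
    funext s a
    have h3 := (Finset.sum_eq_zero_iff_of_nonneg fun s _ =>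
      Finset.sum_nonneg fun a _ => hnn ν' s a).mp h2 s (Finset.mem_univ s)
    have h4 := (Finset.sum_eq_zero_iff_of_nonneg fun a _ => hnn ν' s a).mp h3 a (Finset.mem_univ a)
    have h5 := (mul_eq_zero.mp h4).resolve_left (hdD0 s a).ne'
    exact sub_eq_zero.mp (pow_eq_zero_iff (two_ne_zero)|>.mp h5)
end

section
/- Let f : ℝ → ℝ be differentiable and strictly convex with derivative f' : ℝ → ℝ surjective. Then the objective J₁^f(x) = Σ_{(s,a)} d^D(s,a) f(x(s,a)) − Σ_{(s,a)} d^π(s,a) x(s,a) has a unique minimizer x* over all functions x : S × A → ℝ, and it satisfies f'(x*(s,a)) = w(s,a) for every (s,a) ∈ S × A. -/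
open scoped BigOperators

theorem aux_tangent (f : ℝ → ℝ) (hf : Differentiable ℝ f)
    (hconv : StrictConvexOn ℝ Set.univ f) (x y : ℝ) (h : x ≠ y) :
    f x + deriv f x * (y - x) < f y := by
  rcases lt_or_gt_of_ne h with h | h
  · have := hconv.deriv_lt_slope (Set.mem_univ x) (Set.mem_univ y) h (hf x)
    rw [slope_def_field, lt_div_iff₀ (by linarith)] at this
    linarith
  · have := hconv.slope_lt_deriv (Set.mem_univ y) (Set.mem_univ x) h (hf x)
    rw [slope_def_field, div_lt_iff₀ (by linarith)] at this
    linarith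

theorem J1f_unique_minimizer
    {S A : Type*} [Fintype S] [Fintype A] [Nonempty S] [Nonempty A]
    (T : S → A → S → ℝ) (pi : S → A → ℝ) (beta : S → ℝ) (γ : ℝ) (dD : S → A → ℝ)
    (hT0 : ∀ s a s', 0 ≤ T s a s') (hT1 : ∀ s a, ∑ s', T s a s' = 1)
    (hpi0 : ∀ s a, 0 ≤ pi s a) (hpi1 : ∀ s, ∑ a, pi s a = 1)
    (hbeta0 : ∀ s, 0 ≤ beta s) (hbeta1 : ∑ s, beta s = 1)
    (hγ0 : 0 ≤ γ) (hγ1 : γ < 1)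
    (hdD0 : ∀ s a, 0 < dD s a) (hdD1 : ∑ s, ∑ a, dD s a = 1)
    (w : S → A → ℝ) (hw : ∀ s a, w s a = dPi γ T pi beta s a / dD s a)
    (f : ℝ → ℝ) (hf : Differentiable ℝ f) (hconv : StrictConvexOn ℝ Set.univ f)
    (hsurj : Function.Surjective (deriv f))
    (J1f : (S → A → ℝ) → ℝ)
    (hJ1f : ∀ x : S → A → ℝ,
      J1f x = (∑ s, ∑ a, dD s a * f (x s a))
                - ∑ s, ∑ a, dPi γ T pi beta s a * x s a) :
    ∃ xstar : S → A → ℝ,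
      (∀ x : S → A → ℝ, J1f xstar ≤ J1f x) ∧
      (∀ x' : S → A → ℝ, (∀ x : S → A → ℝ, J1f x' ≤ J1f x) → x' = xstar) ∧
      (∀ s a, deriv f (xstar s a) = w s a) := by
  choose g hg using hsurj
  have hJ : ∀ x : S → A → ℝ, J1f x =
      ∑ s, ∑ a, (dD s a * f (x s a) - dPi γ T pi beta s a * x s a) := by
    intro x
    rw [hJ1f]
    simp only [Finset.sum_sub_distrib]
  have key : ∀ s a y, y ≠ g (w s a) →
      dD s a * f (g (w s a)) - dPi γ T pi beta s a * g (w s a)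
        < dD s a * f y - dPi γ T pi beta s a * y := by
    intro s a y hy
    have h1 := aux_tangent f hf hconv _ y hy.symm
    rw [hg] at h1
    have h2 : dPi γ T pi beta s a = dD s a * w s a := by
      rw [hw, mul_div_cancel₀ _ (hdD0 s a).ne']
    have h3 := mul_lt_mul_of_pos_left h1 (hdD0 s a)
    rw [h2]
    linarith
  have key' : ∀ s a y,
      dD s a * f (g (w s a)) - dPi γ T pi beta s a * g (w s a)
        ≤ dD s a * f y - dPi γ T pi beta s a * y := by
    intro s a y
    by_cases hy : y = g (w s a)
    · rw [hy]
    · exact (key s a y hy).le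
  refine ⟨fun s a => g (w s a), ?_, ?_, fun s a => hg _⟩
  · intro x
    rw [hJ, hJ]
    exact Finset.sum_le_sum fun s _ => Finset.sum_le_sum fun a _ => key' s a _
  · intro x' hx'
    by_contra hne
    have : ∃ s a, x' s a ≠ g (w s a) := by
      by_contra! hcon
      exact hne (funext fun s => funext fun a => hcon s a)
    obtain ⟨s, a, hsa⟩ := this
    have h := hx' (fun s a => g (w s a))
    rw [hJ, hJ] at h
    refine absurd h (not_le.mpr ?_)
    refine Finset.sum_lt_sum (fun s _ => Finset.sum_le_sum fun a _ => key' s a _)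
      ⟨s, Finset.mem_univ s, ?_⟩
    exact Finset.sum_lt_sum (fun a _ => key' s a _) ⟨a, Finset.mem_univ a, key s a _ hsa⟩
end

section
/- Exactness of DualDICE for off-policy policy evaluation: let R̄ : S × A → ℝ be an expected reward function and define the policy value ρ(π) = (1−γ) Σ_{t=0}^∞ γ^t Σ_{s∈S} Σ_{a∈A} β_t(s) π(a|s) R̄(s,a). Then for every saddle point (ν*, ζ*) of the min-max objective J(ν,ζ), the weighted estimate recovers the policy value exactly: Σ_{(s,a)∈S×A} d^D(s,a) ζ*(s,a) R̄(s,a) = ρ(π). -/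
open scoped BigOperators

theorem aux_bound {S A : Type*} [Fintype S] [Fintype A]
    (T : S → A → S → ℝ) (pi : S → A → ℝ) (γ : ℝ)
    (hT0 : ∀ s a s', 0 ≤ T s a s') (hT1 : ∀ s a, ∑ s', T s a s' = 1)
    (hpi0 : ∀ s a, 0 ≤ pi s a) (hpi1 : ∀ s, ∑ a, pi s a = 1) (hγ0 : 0 ≤ γ)
    (ν : S → A → ℝ) (M : ℝ) (h : ∀ s a, |ν s a| ≤ M) (s : S) (a : A) :
    |Bpi γ T pi ν s a| ≤ γ * M := by
  have avg : ∀ s', |∑ a', pi s' a' * ν s' a'| ≤ M := by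
    intro s'
    calc |∑ a', pi s' a' * ν s' a'| ≤ ∑ a', |pi s' a' * ν s' a'| :=
          Finset.abs_sum_le_sum_abs _ _
      _ ≤ ∑ a', pi s' a' * M := by
          refine Finset.sum_le_sum fun a' _ => ?_
          rw [abs_mul, abs_of_nonneg (hpi0 s' a')]
          exact mul_le_mul_of_nonneg_left (h s' a') (hpi0 s' a')
      _ = M := by rw [← Finset.sum_mul, hpi1, one_mul]
  unfold Bpi
  rw [abs_mul, abs_of_nonneg hγ0]
  refine mul_le_mul_of_nonneg_left ?_ hγ0
  calc |∑ s', T s a s' * ∑ a', pi s' a' * ν s' a'|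
      ≤ ∑ s', |T s a s' * ∑ a', pi s' a' * ν s' a'| := Finset.abs_sum_le_sum_abs _ _
    _ ≤ ∑ s', T s a s' * M := by
        refine Finset.sum_le_sum fun s' _ => ?_
        rw [abs_mul, abs_of_nonneg (hT0 s a s')]
        exact mul_le_mul_of_nonneg_left (avg s') (hT0 s a s')
    _ = M := by rw [← Finset.sum_mul, hT1, one_mul]

theorem aux_step {S A : Type*} [Fintype S] [Fintype A]
    (T : S → A → S → ℝ) (pi : S → A → ℝ) (beta : S → ℝ) (γ : ℝ) (ν : S → A → ℝ) (t : ℕ) :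
    ∑ s, ∑ a, betaT T pi beta t s * pi s a * Bpi γ T pi ν s a
      = γ * ∑ s, ∑ a, betaT T pi beta (t + 1) s * pi s a * ν s a := by
  have h1 : ∀ s', ∑ a', betaT T pi beta (t + 1) s' * pi s' a' * ν s' a'
      = ∑ s, ∑ a, betaT T pi beta t s * pi s a * T s a s' * ∑ a', pi s' a' * ν s' a' := by
    intro s'
    simp only [betaT, mul_assoc]
    rw [← Finset.mul_sum, Finset.sum_mul]
    refine Finset.sum_congr rfl fun s _ => ?_
    rw [Finset.sum_mul]
    refine Finset.sum_congr rfl fun a _ => ?_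
    ring
  simp only [h1]
  conv_rhs => rw [Finset.sum_comm, Finset.mul_sum]
  refine Finset.sum_congr rfl fun s _ => ?_
  conv_rhs => rw [Finset.sum_comm, Finset.mul_sum]
  refine Finset.sum_congr rfl fun a _ => ?_
  unfold Bpi
  rw [Finset.mul_sum, Finset.mul_sum, Finset.mul_sum]
  refine Finset.sum_congr rfl fun s' _ => ?_
  ring

theorem aux_iter {S A : Type*} [Fintype S] [Fintype A]
    (T : S → A → S → ℝ) (pi : S → A → ℝ) (beta : S → ℝ) (γ : ℝ) (t : ℕ) :
    ∀ ν : S → A → ℝ, ∑ s, ∑ a, beta s * pi s a * ((Bpi γ T pi)^[t] ν) s a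
      = γ ^ t * ∑ s, ∑ a, betaT T pi beta t s * pi s a * ν s a := by
  induction t with
  | zero => intro ν; simp [betaT]
  | succ t ih =>
    intro ν
    rw [Function.iterate_succ_apply, ih, aux_step]
    ring

theorem aux_linear {S A : Type*} [Fintype S] [Fintype A]
    (T : S → A → S → ℝ) (pi : S → A → ℝ) (γ c : ℝ) (ν μ : S → A → ℝ) (s : S) (a : A) :
    Bpi γ T pi (fun s a => ν s a + c * μ s a) s a
      = Bpi γ T pi ν s a + c * Bpi γ T pi μ s a := by
  unfold Bpi
  have : ∀ s', T s a s' * ∑ a', pi s' a' * (ν s' a' + c * μ s' a')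
      = T s a s' * ∑ a', pi s' a' * ν s' a' + c * (T s a s' * ∑ a', pi s' a' * μ s' a') := by
    intro s'
    have : ∑ a', pi s' a' * (ν s' a' + c * μ s' a')
        = ∑ a', pi s' a' * ν s' a' + c * ∑ a', pi s' a' * μ s' a' := by
      rw [Finset.mul_sum, ← Finset.sum_add_distrib]
      exact Finset.sum_congr rfl fun a' _ => by ring
    rw [this]; ring
  rw [Finset.sum_congr rfl fun s' _ => this s', Finset.sum_add_distrib, ← Finset.mul_sum]
  ring

theorem dualdice_exact_ope
    {S A : Type*} [Fintype S] [Fintype A] [Nonempty S] [Nonempty A]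
    (T : S → A → S → ℝ) (pi : S → A → ℝ) (beta : S → ℝ) (γ : ℝ) (dD : S → A → ℝ)
    (hT0 : ∀ s a s', 0 ≤ T s a s') (hT1 : ∀ s a, ∑ s', T s a s' = 1)
    (hpi0 : ∀ s a, 0 ≤ pi s a) (hpi1 : ∀ s, ∑ a, pi s a = 1)
    (hbeta0 : ∀ s, 0 ≤ beta s) (hbeta1 : ∑ s, beta s = 1)
    (hγ0 : 0 ≤ γ) (hγ1 : γ < 1)
    (hdD0 : ∀ s a, 0 < dD s a) (hdD1 : ∑ s, ∑ a, dD s a = 1)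
    (Rbar : S → A → ℝ) (ρ : ℝ)
    (hρ : ρ = (1 - γ) * ∑' t : ℕ, γ ^ t * ∑ s, ∑ a, betaT T pi beta t s * pi s a * Rbar s a)
    (Jmm : (S → A → ℝ) → (S → A → ℝ) → ℝ)
    (hJmm : ∀ ν ζ : S → A → ℝ,
      Jmm ν ζ = (∑ s, ∑ a, dD s a *
                    ((ν s a - Bpi γ T pi ν s a) * ζ s a - (1 / 2) * (ζ s a) ^ 2))
                  - (1 - γ) * ∑ s, ∑ a, beta s * pi s a * ν s a)
    (νstar ζstar : S → A → ℝ)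
    (hsaddle : ∀ ν ζ : S → A → ℝ,
      Jmm νstar ζ ≤ Jmm νstar ζstar ∧ Jmm νstar ζstar ≤ Jmm ν ζstar) :
    (∑ s, ∑ a, dD s a * ζstar s a * Rbar s a) = ρ := by
  -- first-order condition in ν
  have key : ∀ c : ℝ, ∀ μ : S → A → ℝ,
      Jmm (fun s a => νstar s a + c * μ s a) ζstar = Jmm νstar ζstar
        + c * ((∑ s, ∑ a, dD s a * ζstar s a * (μ s a - Bpi γ T pi μ s a))
          - (1 - γ) * ∑ s, ∑ a, beta s * pi s a * μ s a) := by
    intro c μ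
    rw [hJmm, hJmm]
    simp only [aux_linear]
    have e1 : (∑ s, ∑ a, dD s a * ((νstar s a + c * μ s a
          - (Bpi γ T pi νstar s a + c * Bpi γ T pi μ s a)) * ζstar s a
            - (1 / 2) * (ζstar s a) ^ 2))
        = (∑ s, ∑ a, dD s a *
            ((νstar s a - Bpi γ T pi νstar s a) * ζstar s a - (1 / 2) * (ζstar s a) ^ 2))
          + c * ∑ s, ∑ a, dD s a * ζstar s a * (μ s a - Bpi γ T pi μ s a) := by
      simp only [Finset.mul_sum, ← Finset.sum_add_distrib]
      exact Finset.sum_congr rfl fun s _ => Finset.sum_congr rfl fun a _ => by ring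
    have e2 : (∑ s, ∑ a, beta s * pi s a * (νstar s a + c * μ s a))
        = (∑ s, ∑ a, beta s * pi s a * νstar s a)
          + c * ∑ s, ∑ a, beta s * pi s a * μ s a := by
      simp only [Finset.mul_sum, ← Finset.sum_add_distrib]
      exact Finset.sum_congr rfl fun s _ => Finset.sum_congr rfl fun a _ => by ring
    rw [e1, e2]; ring
  have foc : ∀ μ : S → A → ℝ,
      (∑ s, ∑ a, dD s a * ζstar s a * μ s a)
        - (∑ s, ∑ a, dD s a * ζstar s a * Bpi γ T pi μ s a)
      = (1 - γ) * ∑ s, ∑ a, beta s * pi s a * μ s a := by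
    intro μ
    have h1 := (hsaddle (fun s a => νstar s a + 1 * μ s a) ζstar).2
    have h2 := (hsaddle (fun s a => νstar s a + (-1) * μ s a) ζstar).2
    rw [key] at h1 h2
    have e : (∑ s, ∑ a, dD s a * ζstar s a * (μ s a - Bpi γ T pi μ s a))
        = (∑ s, ∑ a, dD s a * ζstar s a * μ s a)
        - (∑ s, ∑ a, dD s a * ζstar s a * Bpi γ T pi μ s a) := by
      simp only [← Finset.sum_sub_distrib, mul_sub]
    rw [e] at h1 h2
    linarith
  obtain ⟨M, hM⟩ : ∃ M : ℝ, ∀ s a, |Rbar s a| ≤ M := by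
    refine ⟨∑ s, ∑ a, |Rbar s a|, fun s a => ?_⟩
    calc |Rbar s a| ≤ ∑ a, |Rbar s a| :=
          Finset.single_le_sum (f := fun a => |Rbar s a|) (fun _ _ => abs_nonneg _)
            (Finset.mem_univ a)
      _ ≤ _ := Finset.single_le_sum (f := fun s => ∑ a, |Rbar s a|)
            (fun _ _ => Finset.sum_nonneg fun _ _ => abs_nonneg _) (Finset.mem_univ s)
  have hB : ∀ t : ℕ, ∀ s a, |((Bpi γ T pi)^[t] Rbar) s a| ≤ γ ^ t * M := by
    intro t
    induction t with
    | zero => intro s a; simpa using hM s a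
    | succ t ih =>
      intro s a
      rw [Function.iterate_succ_apply']
      have := aux_bound T pi γ hT0 hT1 hpi0 hpi1 hγ0 _ _ ih s a
      calc _ ≤ _ := this
        _ = _ := by ring
  have hlim : ∀ s a, Filter.Tendsto (fun t : ℕ => ((Bpi γ T pi)^[t] Rbar) s a)
      Filter.atTop (nhds 0) := by
    intro s a
    refine squeeze_zero_norm (fun t => by simpa [Real.norm_eq_abs] using hB t s a) ?_
    simpa using (tendsto_pow_atTop_nhds_zero_of_lt_one hγ0 hγ1).mul_const M
  have hFlim : Filter.Tendsto
      (fun t : ℕ => ∑ s, ∑ a, dD s a * ζstar s a * ((Bpi γ T pi)^[t] Rbar) s a)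
      Filter.atTop (nhds 0) := by
    have := tendsto_finsetSum (Finset.univ : Finset S) fun s _ =>
      tendsto_finsetSum (Finset.univ : Finset A) fun a _ =>
        (hlim s a).const_mul (dD s a * ζstar s a)
    simpa using this
  have hsm : Summable fun t : ℕ => ∑ s, ∑ a, beta s * pi s a * ((Bpi γ T pi)^[t] Rbar) s a := by
    refine Summable.of_norm_bounded ((summable_geometric_of_lt_one hγ0 hγ1).mul_right M) ?_
    intro t
    rw [Real.norm_eq_abs]
    calc _ ≤ ∑ s, ∑ a, |beta s * pi s a * ((Bpi γ T pi)^[t] Rbar) s a| :=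
          (Finset.abs_sum_le_sum_abs _ _).trans
            (Finset.sum_le_sum fun s _ => Finset.abs_sum_le_sum_abs _ _)
      _ ≤ ∑ s, ∑ a, beta s * pi s a * (γ ^ t * M) := by
          refine Finset.sum_le_sum fun s _ => Finset.sum_le_sum fun a _ => ?_
          have h0 := mul_nonneg (hbeta0 s) (hpi0 s a)
          rw [abs_mul, abs_of_nonneg h0]
          exact mul_le_mul_of_nonneg_left (hB t s a) h0
      _ = γ ^ t * M := by
          simp only [← Finset.sum_mul, ← Finset.mul_sum, hpi1, mul_one, hbeta1, one_mul]
  have hpart : ∀ n : ℕ, (1 - γ) * ∑ t ∈ Finset.range n,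
        ∑ s, ∑ a, beta s * pi s a * ((Bpi γ T pi)^[t] Rbar) s a
      = (∑ s, ∑ a, dD s a * ζstar s a * Rbar s a)
        - ∑ s, ∑ a, dD s a * ζstar s a * ((Bpi γ T pi)^[n] Rbar) s a := by
    intro n
    induction n with
    | zero => simp
    | succ n ih =>
      rw [Finset.sum_range_succ, mul_add, ih, ← foc, Function.iterate_succ_apply']
      ring
  have l1 := (hsm.hasSum.tendsto_sum_nat).const_mul (1 - γ)
  simp only [hpart] at l1
  have l2 := hFlim.const_sub (∑ s, ∑ a, dD s a * ζstar s a * Rbar s a)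
  rw [sub_zero] at l2
  rw [hρ, tendsto_nhds_unique l2 l1]
  simp only [aux_iter]
end
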